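/- Let p ∈ ℂ[x] be nonzero with n = deg p and c ∈ ℂ such that p(x) = (−1)^n p(−x + c). Then every parabolic subalgebra of 𝒟_p^± is nondegenerate: if 𝔭 = ⊕_{j∈ℤ} 𝔭_j is a ℤ-graded Lie subalgebra of 𝒟_p^± with 𝔭_j = (𝒟_p^±)_j for all j ≥ 0 and 𝔭_{−j₀} ≠ 0 for some j₀ ≥ 1, then for every j ≥ 1 the subspace 𝔭_{−j} is nonzero and has finite codimension in (𝒟_p^±)_{−j}. -/

import Mathlib

noncomputable section

/-- ℂ[t,t⁻¹] as a ℂ-vector space with basis {t^j}_{j∈ℤ}; t^j is `Finsupp.single j 1`. -/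
abbrev LaurentV : Type := ℤ →₀ ℂ

/-- The regular differential operator `t^k f(D)` (where D = t·d/dt), acting by
t^j ↦ f(j)·t^{j+k}. -/
def op (k : ℤ) (f : Polynomial ℂ) : Module.End ℂ LaurentV :=
  Finsupp.lsum ℂ fun j => f.eval (j : ℂ) • Finsupp.lsingle (j + k)

/-- The graded piece (𝒟ᵃ_p)_j = {t^j f(D) p(D) : f ∈ ℂ[x]}. -/
def Dgrade (p : Polynomial ℂ) (j : ℤ) : Submodule ℂ (Module.End ℂ LaurentV) :=
  Submodule.span ℂ {A | ∃ f : Polynomial ℂ, A = op j (f * p)}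

/-- 𝒟ᵃ_p = 𝒟ᵃ·p(D). -/
def Dp (p : Polynomial ℂ) : Submodule ℂ (Module.End ℂ LaurentV) :=
  Submodule.span ℂ {A | ∃ (k : ℤ) (f : Polynomial ℂ), A = op k (f * p)}

/-- σ is an anti-involution: it is ℂ-linear (built into the type), involutive, and
reverses products. -/
def IsAntiInvolutionOn (p : Polynomial ℂ) (σ : ↥(Dp p) →ₗ[ℂ] ↥(Dp p)) : Prop :=
  (∀ A : ↥(Dp p), σ (σ A) = A) ∧
  (∀ A B W : ↥(Dp p),
    (W : Module.End ℂ LaurentV) = (A : Module.End ℂ LaurentV) * (B : Module.End ℂ LaurentV) →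
    ((σ W : Module.End ℂ LaurentV)) = (σ B : Module.End ℂ LaurentV) * (σ A : Module.End ℂ LaurentV))

/-- σ preserves the principal ℤ-gradation. -/
def PreservesGrading (p : Polynomial ℂ) (σ : ↥(Dp p) →ₗ[ℂ] ↥(Dp p)) : Prop :=
  ∀ (j : ℤ) (A : ↥(Dp p)), (A : Module.End ℂ LaurentV) ∈ Dgrade p j →
    ((σ A : Module.End ℂ LaurentV)) ∈ Dgrade p j

/-- σ(t^k f(D) p(D)) = (-1)^{deg p}·e^k·t^k f(−D−k+c)p(D). -/
def SigmaFormula (p : Polynomial ℂ) (c e : ℂ) (σ : ↥(Dp p) →ₗ[ℂ] ↥(Dp p)) : Prop :=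
  ∀ (k : ℤ) (f : Polynomial ℂ) (A : ↥(Dp p)), (A : Module.End ℂ LaurentV) = op k (f * p) →
    ((σ A : Module.End ℂ LaurentV)) =
      ((-1 : ℂ) ^ p.natDegree * e ^ k) •
        op k ((f.comp (Polynomial.C (c - (k : ℂ)) - Polynomial.X)) * p)

/-- The graded piece (𝒟_p^±)_k = {d ∈ (𝒟_p)_k : σ_±(d) = −d}, as a set. -/
def DpmGradeSet (p : Polynomial ℂ) (c e : ℂ) (k : ℤ) : Set (Module.End ℂ LaurentV) :=
  {A | ∃ f : Polynomial ℂ, A = op k (f * p) ∧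
    ((-1 : ℂ) ^ p.natDegree * e ^ k) •
      op k ((f.comp (Polynomial.C (c - (k : ℂ)) - Polynomial.X)) * p) = -A}

/-- The graded piece (𝒟_p^±)_k, as a ℂ-subspace. -/
def DpmGrade (p : Polynomial ℂ) (c e : ℂ) (k : ℤ) : Submodule ℂ (Module.End ℂ LaurentV) :=
  Submodule.span ℂ (DpmGradeSet p c e k)

/-- V has finite codimension in W. -/
def FinCodimIn {M : Type*} [AddCommGroup M] [Module ℂ M] (V W : Submodule ℂ M) : Prop :=
  FiniteDimensional ℂ (↥W ⧸ Submodule.comap W.subtype V)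


open Polynomial in
theorem op_apply_single (k : ℤ) (f : ℂ[X]) (j : ℤ) (a : ℂ) :
    op k f (Finsupp.single j a) = Finsupp.single (j + k) (f.eval (j : ℂ) * a) := by
  simp [op]

open Polynomial in
theorem op_add (k : ℤ) (f g : ℂ[X]) : op k (f + g) = op k f + op k g := by
  apply Finsupp.lhom_ext
  intro j a
  simp only [LinearMap.add_apply, op_apply_single, eval_add, add_mul, Finsupp.single_add]

open Polynomial in
theorem op_smul (k : ℤ) (a : ℂ) (f : ℂ[X]) : op k (a • f) = a • op k f := by
  apply Finsupp.lhom_ext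
  intro j b
  simp only [LinearMap.smul_apply, op_apply_single, eval_smul, smul_eq_mul, Finsupp.smul_single,
    mul_assoc]

open Polynomial in
/-- `f ↦ t^k f(D)` as a linear map. -/
def opLinear (k : ℤ) : ℂ[X] →ₗ[ℂ] Module.End ℂ LaurentV where
  toFun := op k
  map_add' := op_add k
  map_smul' := op_smul k

open Polynomial in
theorem op_injective (k : ℤ) : Function.Injective (op k) := by
  intro f g h
  apply eq_of_infinite_eval_eq f g
  refine (Set.infinite_range_of_injective (Int.cast_injective (α := ℂ))).mono ?_
  rintro _ ⟨j, rfl⟩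
  have := congrArg (fun A : Module.End ℂ LaurentV => A (Finsupp.single j 1) (j + k)) h
  simpa [op_apply_single] using this

open Polynomial in
theorem op_mul_op (i j : ℤ) (f g : ℂ[X]) :
    op i f * op j g = op (i + j) (taylor (j : ℂ) f * g) := by
  apply Finsupp.lhom_ext
  intro m a
  rw [Module.End.mul_apply]
  simp only [op_apply_single, eval_mul, taylor_eval]
  rw [add_assoc m j i, add_comm j i]
  push_cast
  rw [mul_assoc]

open Polynomial in
theorem lie_op_op (i j : ℤ) (f g : ℂ[X]) :
    ⁅op i f, op j g⁆ = op (i + j) (taylor (j : ℂ) f * g - taylor (i : ℂ) g * f) := by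
  have h := map_sub (opLinear (i + j)) (taylor (j : ℂ) f * g) (taylor (i : ℂ) g * f)
  change op _ _ = op _ _ - op _ _ at h
  rw [h, Ring.lie_def, op_mul_op, op_mul_op, add_comm j i]

open Polynomial in
theorem natDegree_X_mul_taylor_sub_le (r : ℂ) (f : ℂ[X]) :
    (X * (taylor r f - f)).natDegree ≤ f.natDegree := by
  rw [natDegree_le_iff_coeff_eq_zero]
  rintro (_ | m) hm
  · simp
  rw [coeff_X_mul, coeff_sub]
  rcases (Nat.lt_succ_iff.mp hm).lt_or_eq with h | h
  · rw [coeff_eq_zero_of_natDegree_lt h, coeff_eq_zero_of_natDegree_lt (by simpa using h),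
      sub_zero]
  · rw [← h, taylor_coeff, sub_eq_zero]
    have h0 : (hasseDeriv f.natDegree f).natDegree ≤ 0 := by
      simpa using natDegree_hasseDeriv_le f f.natDegree
    rw [eq_C_of_natDegree_le_zero h0, eval_C, hasseDeriv_coeff]
    simp

open Polynomial in
theorem coeff_X_mul_taylor_sub (r : ℂ) (f : ℂ[X]) :
    (X * (taylor r f - f)).coeff f.natDegree = f.natDegree * r * f.leadingCoeff := by
  rw [leadingCoeff]
  rcases hd : f.natDegree with _ | m
  · simp
  rw [coeff_X_mul, coeff_sub, taylor_coeff]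
  have h1 : (hasseDeriv m f).natDegree ≤ 1 := by
    have := natDegree_hasseDeriv_le f m
    omega
  rw [eq_X_add_C_of_natDegree_le_one h1]
  simp only [hasseDeriv_coeff, eval_add, eval_mul, eval_C, eval_X, add_comm 1 m,
    Nat.choose_succ_self_right, zero_add, Nat.choose_self]
  push_cast
  ring

open Polynomial in
/-- The symbol of a commutator drops by exactly one degree unless its subleading coefficient
vanishes. -/
theorem natDegree_taylor_commutator {f g : ℂ[X]} (hf : f ≠ 0) (hg : g ≠ 0) {i j : ℤ}
    (h : j * (f.natDegree : ℤ) ≠ i * (g.natDegree : ℤ)) :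
    taylor (j : ℂ) f * g - taylor (i : ℂ) g * f ≠ 0 ∧
      (taylor (j : ℂ) f * g - taylor (i : ℂ) g * f).natDegree + 1 =
        f.natDegree + g.natDegree := by
  set H := taylor (j : ℂ) f * g - taylor (i : ℂ) g * f with hH
  have hX : X * H = X * (taylor (j : ℂ) f - f) * g - f * (X * (taylor (i : ℂ) g - g)) := by
    rw [hH]; ring
  have hle : (X * H).natDegree ≤ f.natDegree + g.natDegree := by
    rw [hX]
    apply (natDegree_sub_le _ _).trans
    apply max_le
    · exact natDegree_mul_le_of_le (natDegree_X_mul_taylor_sub_le _ _) le_rfl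
    · exact natDegree_mul_le_of_le le_rfl (natDegree_X_mul_taylor_sub_le _ _)
  have hc : (X * H).coeff (f.natDegree + g.natDegree) ≠ 0 := by
    rw [hX, coeff_sub, coeff_mul_add_eq_of_natDegree_le (natDegree_X_mul_taylor_sub_le _ _) le_rfl,
      coeff_mul_add_eq_of_natDegree_le le_rfl (natDegree_X_mul_taylor_sub_le _ _),
      coeff_X_mul_taylor_sub, coeff_X_mul_taylor_sub, coeff_natDegree, coeff_natDegree]
    have h' : (j : ℂ) * f.natDegree - i * g.natDegree ≠ 0 := by
      rw [sub_ne_zero]; exact_mod_cast h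
    have := mul_ne_zero h' (mul_ne_zero (leadingCoeff_ne_zero.mpr hf) (leadingCoeff_ne_zero.mpr hg))
    convert this using 1
    ring
  have hH0 : H ≠ 0 := by
    intro h0
    simp [h0] at hc
  refine ⟨hH0, ?_⟩
  rw [← natDegree_X_mul hH0]
  exact le_antisymm hle (le_natDegree_of_ne_zero hc)

open Polynomial in
/-- Some nonzero `t^k f(D)` with `f` of degree `d` lies in `V`. -/
def HasSymbolDegree (V : Submodule ℂ (Module.End ℂ LaurentV)) (k : ℤ) (d : ℕ) : Prop :=
  ∃ f : ℂ[X], f ≠ 0 ∧ f.natDegree = d ∧ op k f ∈ V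

theorem HasSymbolDegree.ne_bot {V : Submodule ℂ (Module.End ℂ LaurentV)} {k : ℤ} {d : ℕ}
    (h : HasSymbolDegree V k d) : V ≠ ⊥ := by
  obtain ⟨f, hf, -, hV⟩ := h
  rintro rfl
  exact hf (op_injective k (((Submodule.mem_bot ℂ).mp hV).trans (opLinear k).map_zero.symm))

theorem HasSymbolDegree.lie {𝔭 : ℤ → Submodule ℂ (Module.End ℂ LaurentV)}
    (hbrk : ∀ (i j : ℤ) (x y : Module.End ℂ LaurentV),
      x ∈ 𝔭 i → y ∈ 𝔭 j → ⁅x, y⁆ ∈ 𝔭 (i + j)) {i j : ℤ} {a b d : ℕ}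
    (ha : HasSymbolDegree (𝔭 i) i a) (hb : HasSymbolDegree (𝔭 j) j b)
    (hab : j * (a : ℤ) ≠ i * (b : ℤ)) (hd : d + 1 = a + b) :
    HasSymbolDegree (𝔭 (i + j)) (i + j) d := by
  obtain ⟨f, hf, rfl, hfV⟩ := ha
  obtain ⟨g, hg, rfl, hgV⟩ := hb
  obtain ⟨h0, h1⟩ := natDegree_taylor_commutator hf hg hab
  refine ⟨_, h0, by omega, ?_⟩
  rw [← lie_op_op]
  exact hbrk i j _ _ hfV hgV

open Polynomial in
theorem exists_eq_op_of_mem_DpmGrade {p : ℂ[X]} (hp : p ≠ 0) {c e : ℂ} {k : ℤ}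
    {x : Module.End ℂ LaurentV} (hx : x ∈ DpmGrade p c e k) :
    ∃ f : ℂ[X], x = op k (f * p) ∧
      ((-1 : ℂ) ^ p.natDegree * e ^ k) • f.comp (C (c - (k : ℂ)) - X) = -f := by
  induction hx using Submodule.span_induction with
  | mem x hx =>
    obtain ⟨f, rfl, hf⟩ := hx
    refine ⟨f, rfl, mul_right_cancel₀ hp (op_injective k ?_)⟩
    rw [smul_mul_assoc, op_smul, hf, neg_mul]
    exact (map_neg (opLinear k) _).symm
  | zero => exact ⟨0, by rw [zero_mul]; exact (opLinear k).map_zero.symm, by simp⟩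
  | add x y _ _ hx hy =>
    obtain ⟨f, rfl, hf⟩ := hx
    obtain ⟨g, rfl, hg⟩ := hy
    refine ⟨f + g, by rw [add_mul, op_add], ?_⟩
    rw [add_comp, smul_add, hf, hg, neg_add]
  | smul a x _ hx =>
    obtain ⟨f, rfl, hf⟩ := hx
    refine ⟨a • f, by rw [smul_mul_assoc, op_smul], ?_⟩
    rw [smul_comp, smul_comm, hf, smul_neg]

open Polynomial in
theorem neg_one_pow_natDegree_of_reflect {f : ℂ[X]} (hf : f ≠ 0) {a b : ℂ}
    (h : a • f.comp (C b - X) = -f) : a * (-1) ^ f.natDegree = -1 := by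
  have hq : (C b - X : ℂ[X]).natDegree = 1 := by
    rw [← neg_sub, natDegree_neg, natDegree_X_sub_C]
  have hl : (C b - X : ℂ[X]).leadingCoeff = -1 := by
    rw [← neg_sub, leadingCoeff_neg, leadingCoeff_X_sub_C]
  have h2 := congrArg leadingCoeff h
  rw [leadingCoeff_neg, smul_eq_C_mul, leadingCoeff_mul, leadingCoeff_C,
    leadingCoeff_comp (by rw [hq]; exact one_ne_zero), hl] at h2
  apply mul_left_cancel₀ (leadingCoeff_ne_zero.mpr hf)
  linear_combination h2

theorem sign_zpow_mul_self {e : ℂ} (he : e = 1 ∨ e = -1) (k : ℤ) : e ^ k * e ^ k = 1 := by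
  have : e * e = 1 := by rcases he with rfl | rfl <;> norm_num
  rw [← mul_zpow, this, one_zpow]

open Polynomial in
/-- The parity of the symbol degree is constant on each graded piece. -/
theorem exists_symbol_of_mem_DpmGrade {p : ℂ[X]} (hp : p ≠ 0) {c e : ℂ}
    (he : e = 1 ∨ e = -1) {k : ℤ} {x : Module.End ℂ LaurentV} (hx : x ∈ DpmGrade p c e k) :
    ∃ f : ℂ[X], x = op k f ∧ (f ≠ 0 → (-1 : ℂ) ^ f.natDegree = -e ^ k) := by
  obtain ⟨f, rfl, hf⟩ := exists_eq_op_of_mem_DpmGrade hp hx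
  refine ⟨f * p, rfl, fun h => ?_⟩
  have hf0 : f ≠ 0 := left_ne_zero_of_mul h
  have := neg_one_pow_natDegree_of_reflect hf0 hf
  rw [natDegree_mul hf0 hp, pow_add]
  linear_combination e ^ k * this - (-1) ^ p.natDegree * (-1) ^ f.natDegree *
    sign_zpow_mul_self he k

open Polynomial in
theorem hasSymbolDegree_DpmGrade {p : ℂ[X]} (hp : p ≠ 0) (c : ℂ) {e : ℂ}
    (he : e = 1 ∨ e = -1) {k : ℤ} {d : ℕ} (hd : p.natDegree ≤ d)
    (hpar : (-1 : ℂ) ^ d = -e ^ k) : HasSymbolDegree (DpmGrade p c e k) k d := by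
  obtain ⟨m, rfl⟩ := Nat.exists_eq_add_of_le hd
  have hq : (X - C ((c - k) / 2) : ℂ[X]) ^ m ≠ 0 := pow_ne_zero _ (X_sub_C_ne_zero _)
  refine ⟨(X - C ((c - k) / 2)) ^ m * p, mul_ne_zero hq hp, ?_,
    Submodule.subset_span ⟨_, rfl, ?_⟩⟩
  · rw [natDegree_mul hq hp, natDegree_pow, natDegree_X_sub_C]; ring
  · have hc : ((X - C ((c - k) / 2) : ℂ[X]) ^ m).comp (C (c - (k : ℂ)) - X) =
        ((-1 : ℂ) ^ m) • (X - C ((c - k) / 2)) ^ m := by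
      have hb : (C (c - (k : ℂ)) : ℂ[X]) = C ((c - k) / 2) + C ((c - k) / 2) := by
        rw [← C_add, add_halves]
      rw [pow_comp, sub_comp, X_comp, C_comp, hb, smul_eq_C_mul, C_pow, ← mul_pow]
      congr 1
      rw [C_neg, C_1]
      ring
    rw [hc, smul_mul_assoc, op_smul, smul_smul, ← neg_one_smul ℂ (op k _)]
    congr 1
    rw [pow_add] at hpar
    linear_combination e ^ k * hpar - sign_zpow_mul_self he k

theorem exists_hasSymbolDegree_of_ne_bot {p : Polynomial ℂ} (hp : p ≠ 0) {c e : ℂ}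
    (he : e = 1 ∨ e = -1) {k : ℤ} {V : Submodule ℂ (Module.End ℂ LaurentV)}
    (hV : V ≤ DpmGrade p c e k) (h : V ≠ ⊥) :
    ∃ d, (-1 : ℂ) ^ d = -e ^ k ∧ HasSymbolDegree V k d := by
  obtain ⟨x, hxV, hx⟩ := Submodule.exists_mem_ne_zero_of_ne_bot h
  obtain ⟨f, rfl, hf⟩ := exists_symbol_of_mem_DpmGrade hp he (hV hxV)
  have hf0 : f ≠ 0 := by
    rintro rfl
    exact hx (opLinear k).map_zero
  exact ⟨_, hf hf0, f, hf0, rfl, hxV⟩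

theorem finCodimIn_of_le_sup {M : Type*} [AddCommGroup M] [Module ℂ M] {V W U : Submodule ℂ M}
    [FiniteDimensional ℂ U] (h : W ≤ V ⊔ U) : FinCodimIn V W := by
  have hle : LinearMap.range (V.mkQ ∘ₗ W.subtype) ≤ U.map V.mkQ := by
    rw [LinearMap.range_comp, Submodule.range_subtype]
    refine (Submodule.map_mono h).trans ?_
    rw [Submodule.map_sup, Submodule.mkQ_map_self, bot_sup_eq]
  have : FiniteDimensional ℂ (LinearMap.range (V.mkQ ∘ₗ W.subtype)) :=
    Submodule.finiteDimensional_of_le hle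
  have hk : LinearMap.ker (V.mkQ ∘ₗ W.subtype) = Submodule.comap W.subtype V := by
    rw [LinearMap.ker_comp, Submodule.ker_mkQ]
  unfold FinCodimIn
  rw [← hk]
  exact (V.mkQ ∘ₗ W.subtype).quotKerEquivRange.symm.finiteDimensional

open Polynomial in
theorem finCodimIn_DpmGrade {p : ℂ[X]} (hp : p ≠ 0) {c e : ℂ} (he : e = 1 ∨ e = -1) {k : ℤ}
    {V : Submodule ℂ (Module.End ℂ LaurentV)} (hV : V ≤ DpmGrade p c e k) (N : ℕ)
    (h : ∀ d, N ≤ d → (-1 : ℂ) ^ d = -e ^ k → HasSymbolDegree V k d) :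
    FinCodimIn (M := Module.End ℂ LaurentV) V (DpmGrade p c e k) := by
  have key : ∀ (m : ℕ) (f : ℂ[X]), f.natDegree < m → op k f ∈ DpmGrade p c e k →
      op k f ∈ V ⊔ (degreeLT ℂ N).map (opLinear k) := by
    intro m
    induction m with
    | zero => intro f hf; omega
    | succ m ih =>
      intro f hfm hf
      by_cases hN : f.degree < N
      · exact Submodule.mem_sup_right ⟨f, mem_degreeLT.mpr hN, rfl⟩
      have hf0 : f ≠ 0 := by
        rintro rfl
        exact hN (by simp)
      obtain ⟨f', hff', hpar⟩ := exists_symbol_of_mem_DpmGrade hp he hf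
      obtain rfl := op_injective k hff'
      rw [degree_eq_natDegree hf0, not_lt, Nat.cast_le] at hN
      obtain ⟨g, hg0, hgd, hgV⟩ := h _ hN (hpar hf0)
      set a := f.leadingCoeff / g.leadingCoeff with ha
      have hlg := leadingCoeff_ne_zero.mpr hg0
      have hsplit : op k f = a • op k g + op k (f - a • g) := by
        rw [← op_smul, ← op_add, add_sub_cancel]
      have hagV : a • op k g ∈ V := V.smul_mem a hgV
      rw [hsplit]
      refine add_mem (Submodule.mem_sup_left hagV) ?_
      have hmem : op k (f - a • g) ∈ DpmGrade p c e k := by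
        rw [sub_eq_add_neg, ← neg_smul, op_add, op_smul]
        exact add_mem hf (Submodule.smul_mem _ _ (hV hgV))
      by_cases hr : f - a • g = 0
      · rw [hr]
        have : op k 0 = 0 := (opLinear k).map_zero
        rw [this]
        exact zero_mem _
      apply ih _ _ hmem
      have ha0 : a ≠ 0 := div_ne_zero (leadingCoeff_ne_zero.mpr hf0) hlg
      have hlt : (f - a • g).degree < f.degree := by
        apply degree_sub_lt_left _ hf0
        · rw [smul_eq_C_mul, leadingCoeff_mul, leadingCoeff_C, ha, div_mul_cancel₀ _ hlg]
        · rw [smul_eq_C_mul, degree_C_mul ha0, degree_eq_natDegree hf0, degree_eq_natDegree hg0,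
            hgd]
      have := natDegree_lt_natDegree hr hlt
      omega
  have : FiniteDimensional ℂ (degreeLT ℂ N) :=
    (degreeLTEquiv ℂ N).symm.finiteDimensional
  apply finCodimIn_of_le_sup (U := (degreeLT ℂ N).map (opLinear k))
  intro x hx
  obtain ⟨f, rfl, -⟩ := exists_symbol_of_mem_DpmGrade hp he hx
  exact key _ f (Nat.lt_succ_self _) hx

theorem parabolic_nondegenerate (p : Polynomial ℂ) (hp : p ≠ 0) (c : ℂ)
    (hpc : ∀ x : ℂ, p.eval x = (-1 : ℂ) ^ p.natDegree * p.eval (-x + c))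
    (e : ℂ) (he : e = 1 ∨ e = -1)
    (𝔭 : ℤ → Submodule ℂ (Module.End ℂ LaurentV))
    (hsub : ∀ j : ℤ, 𝔭 j ≤ DpmGrade p c e j)
    (hbrk : ∀ (i j : ℤ) (x y : Module.End ℂ LaurentV),
      x ∈ 𝔭 i → y ∈ 𝔭 j → ⁅x, y⁆ ∈ 𝔭 (i + j))
    (hpos : ∀ j : ℤ, 0 ≤ j → 𝔭 j = DpmGrade p c e j)
    (hex : ∃ j₀ : ℤ, 1 ≤ j₀ ∧ 𝔭 (-j₀) ≠ ⊥) :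
    ∀ j : ℤ, 1 ≤ j → 𝔭 (-j) ≠ ⊥ ∧ FinCodimIn (M := Module.End ℂ LaurentV) (𝔭 (-j)) (DpmGrade p c e (-j)) := by
  have hfin : ∀ j : ℤ, 1 ≤ j → 𝔭 (-j) ≠ ⊥ → ∃ N : ℕ, ∀ d, N ≤ d → (-1 : ℂ) ^ d = -e ^ (-j) →
      HasSymbolDegree (𝔭 (-j)) (-j) d := by
    intro j hj hne
    obtain ⟨b, hb, hbV⟩ := exists_hasSymbolDegree_of_ne_bot hp he (hsub (-j)) hne
    refine ⟨p.natDegree + b + 1, fun d hd hpar => ?_⟩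
    obtain ⟨a, rfl⟩ : ∃ a, d = a + b := ⟨d - b, by omega⟩
    have ha : (-1 : ℂ) ^ (a + 1) = -e ^ (0 : ℤ) := by
      rw [pow_add, ← hb] at hpar
      have := mul_right_cancel₀ (pow_ne_zero b (by norm_num : (-1 : ℂ) ≠ 0))
        (hpar.trans (one_mul _).symm)
      rw [pow_succ, this]
      simp
    have h0 := hasSymbolDegree_DpmGrade hp c he (k := 0) (d := a + 1) (by omega) ha
    rw [← hpos 0 le_rfl] at h0
    have h1 := h0.lie (d := a + b) hbrk hbV (by push_cast; nlinarith) (by omega)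
    rwa [zero_add] at h1
  have hdown : ∀ m : ℕ, 𝔭 (-((m : ℤ) + 1)) ≠ ⊥ → 𝔭 (-1) ≠ ⊥ := by
    intro m
    induction m with
    | zero => intro h; simpa using h
    | succ m ih =>
      intro h
      apply ih
      obtain ⟨b, -, hbV⟩ := exists_hasSymbolDegree_of_ne_bot hp he (hsub _) h
      obtain ⟨a, han, hapos, ha⟩ :
          ∃ a, p.natDegree ≤ a ∧ 1 ≤ a ∧ (-1 : ℂ) ^ a = -e ^ (1 : ℤ) := by
        rcases he with rfl | rfl
        · exact ⟨2 * p.natDegree + 1, by omega, by omega, by simp [pow_succ, pow_mul]⟩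
        · exact ⟨2 * p.natDegree + 2, by omega, by omega, by simp [pow_succ, pow_mul]⟩
      have h1 := hasSymbolDegree_DpmGrade hp c he (k := 1) han ha
      rw [← hpos 1 zero_le_one] at h1
      have h2 := h1.lie (d := a + b - 1) hbrk hbV (by push_cast; nlinarith) (by omega)
      have := h2.ne_bot
      convert this using 2
      push_cast
      ring
  have hone : 𝔭 (-1) ≠ ⊥ := by
    obtain ⟨j₀, hj₀, h⟩ := hex
    obtain ⟨m, rfl⟩ : ∃ m : ℕ, j₀ = m + 1 := ⟨(j₀ - 1).toNat, by omega⟩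
    exact hdown m h
  have hup : ∀ m : ℕ, 𝔭 (-((m : ℤ) + 1)) ≠ ⊥ := by
    intro m
    induction m with
    | zero => simpa using hone
    | succ m ih =>
      obtain ⟨b, -, hbV⟩ := exists_hasSymbolDegree_of_ne_bot hp he (hsub _) ih
      obtain ⟨N, hN⟩ := hfin 1 le_rfl hone
      obtain ⟨a, haN, hab, ha⟩ : ∃ a, N ≤ a ∧ b < a ∧ (-1 : ℂ) ^ a = -e ^ (-1 : ℤ) := by
        rcases he with rfl | rfl
        · exact ⟨2 * (N + b) + 1, by omega, by omega, by simp [pow_succ, pow_mul]⟩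
        · exact ⟨2 * (N + b) + 2, by omega, by omega, by simp [pow_succ, pow_mul]⟩
      have h2 := (hN a haN ha).lie (d := a + b - 1) hbrk hbV (by nlinarith) (by omega)
      have := h2.ne_bot
      convert this using 2
      push_cast
      ring
  intro j hj
  have hne : 𝔭 (-j) ≠ ⊥ := by
    obtain ⟨m, rfl⟩ : ∃ m : ℕ, j = m + 1 := ⟨(j - 1).toNat, by omega⟩
    exact hup m
  obtain ⟨N, hN⟩ := hfin j hj hne
  exact ⟨hne, finCodimIn_DpmGrade hp he (hsub _) N hN⟩

end
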